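/- arXiv:1610.09208 — 2 statements merged into one kernel-verified Lean document; each statement's English description precedes it below -/
import Mathlib

section
/- Let F be a binary cubic form with integer coefficients, non-zero discriminant, and non-zero x³-coefficient. Then Aut F is the cyclic group of order 3 generated by the matrix 𝒩_{q_F} ∈ GL₂(ℚ) if and only if F is irreducible over ℚ and Δ(F) is the square of a rational number. -/
/-- The principal square root of a complex number: non-negative real part, and positive
imaginary part when the real part vanishes. -/
noncomputable def csqrt (z : ℂ) : ℂ := z ^ ((1 : ℂ) / 2)

/-- The binary cubic form `F(x,y) = b₃x³ + b₂x²y + b₁xy² + b₀y³` over `ℚ`, with integer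
coefficients. -/
def cubicFormQ (b₃ b₂ b₁ b₀ : ℤ) (x y : ℚ) : ℚ :=
  (b₃ : ℚ) * x ^ 3 + (b₂ : ℚ) * x ^ 2 * y + (b₁ : ℚ) * x * y ^ 2 + (b₀ : ℚ) * y ^ 3

/-- The discriminant of the binary cubic form with coefficients `b₃, b₂, b₁, b₀`. -/
def cubicDisc (b₃ b₂ b₁ b₀ : ℤ) : ℤ :=
  18 * b₃ * b₂ * b₁ * b₀ - 4 * b₂ ^ 3 * b₀ + b₂ ^ 2 * b₁ ^ 2
    - 4 * b₃ * b₁ ^ 3 - 27 * b₃ ^ 2 * b₀ ^ 2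

/-- The rational automorphism group of the cubic form, as a set of non-singular rational
`2 × 2` matrices fixing `F` under the substitution action. -/
def cubicAut (b₃ b₂ b₁ b₀ : ℤ) : Set (Matrix (Fin 2) (Fin 2) ℚ) :=
  {T | T.det ≠ 0 ∧ ∀ x y : ℚ,
    cubicFormQ b₃ b₂ b₁ b₀ (T 0 0 * x + T 0 1 * y) (T 1 0 * x + T 1 1 * y)
      = cubicFormQ b₃ b₂ b₁ b₀ x y}

/-- `F` has a linear factor with rational coefficients. (`F` is irreducible over `ℚ` iff
this fails.) -/
def HasRationalLinearFactor (b₃ b₂ b₁ b₀ : ℤ) : Prop :=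
  ∃ p q c₂ c₁ c₀ : ℚ, ∀ x y : ℚ,
    cubicFormQ b₃ b₂ b₁ b₀ x y = (p * x + q * y) * (c₂ * x ^ 2 + c₁ * x * y + c₀ * y ^ 2)

/-- The matrix `N_f` attached to the binary quadratic form `f = ax² + bxy + cy²`:
`N_f = (1/(2Δ(f))) ⬝ [[b√(−3Δ(f)) − Δ(f), 2c√(−3Δ(f))], [−2a√(−3Δ(f)), −b√(−3Δ(f)) − Δ(f)]]`. -/
noncomputable def Nmat (a b c : ℂ) : Matrix (Fin 2) (Fin 2) ℂ :=
  (2 * (b ^ 2 - 4 * a * c))⁻¹ •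
    !![b * csqrt (-3 * (b ^ 2 - 4 * a * c)) - (b ^ 2 - 4 * a * c),
        2 * c * csqrt (-3 * (b ^ 2 - 4 * a * c));
      -2 * a * csqrt (-3 * (b ^ 2 - 4 * a * c)),
        -(b * csqrt (-3 * (b ^ 2 - 4 * a * c))) - (b ^ 2 - 4 * a * c)]

/-- The matrix `𝒩_{q_F}` attached to the Hessian covariant
`q_F = (b₂² − 3b₃b₁)x² + (b₂b₁ − 9b₃b₀)xy + (b₁² − 3b₂b₀)y²` of the cubic form `F`. -/
noncomputable def NqF (b₃ b₂ b₁ b₀ : ℤ) : Matrix (Fin 2) (Fin 2) ℂ :=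
  Nmat ((b₂ ^ 2 - 3 * b₃ * b₁ : ℤ) : ℂ) ((b₂ * b₁ - 9 * b₃ * b₀ : ℤ) : ℂ)
    ((b₁ ^ 2 - 3 * b₂ * b₀ : ℤ) : ℂ)

/-- The matrix `(t + k J) / 2`, where `J` is the traceless matrix attached to `ax² + bxy + cy²`. -/
def pencil (a b c t k : ℚ) : Matrix (Fin 2) (Fin 2) ℚ :=
  !![(t - b * k) / 2, -c * k; a * k, (t + b * k) / 2]

theorem cubicDisc_cast (b₃ b₂ b₁ b₀ : ℤ) :
    -3 * (cubicDisc b₃ b₂ b₁ b₀ : ℚ) = ((b₂ * b₁ - 9 * b₃ * b₀ : ℤ) : ℚ) ^ 2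
      - 4 * ((b₂ ^ 2 - 3 * b₃ * b₁ : ℤ) : ℚ) * ((b₁ ^ 2 - 3 * b₂ * b₀ : ℤ) : ℚ) := by
  unfold cubicDisc
  push_cast
  ring

theorem hasRationalLinearFactor_of_zero {b₃ b₂ b₁ b₀ : ℤ} (hb₃ : b₃ ≠ 0) {m n : ℚ}
    (h : cubicFormQ b₃ b₂ b₁ b₀ m n = 0) (hmn : m ≠ 0 ∨ n ≠ 0) :
    HasRationalLinearFactor b₃ b₂ b₁ b₀ := by
  have hb : (b₃ : ℚ) ≠ 0 := by exact_mod_cast hb₃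
  unfold cubicFormQ at h
  have hn : n ≠ 0 := by
    rintro rfl
    have : m = 0 := by simpa [hb] using h
    simp [this] at hmn
  obtain ⟨ρ, rfl⟩ : ∃ ρ, m = ρ * n := ⟨m / n, by field_simp⟩
  have hρ : (b₃ : ℚ) * ρ ^ 3 + b₂ * ρ ^ 2 + b₁ * ρ + b₀ = 0 := by
    have : n ^ 3 * ((b₃ : ℚ) * ρ ^ 3 + b₂ * ρ ^ 2 + b₁ * ρ + b₀) = 0 := by
      linear_combination h
    simpa [hn] using this
  refine ⟨1, -ρ, b₃, b₂ + b₃ * ρ, b₁ + b₂ * ρ + b₃ * ρ ^ 2, fun x y => ?_⟩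
  unfold cubicFormQ
  linear_combination y ^ 3 * hρ

/-- A cubic form with a rational linear factor has an automorphism of determinant `-1`. -/
theorem exists_mem_cubicAut_det_eq_neg_one {b₃ b₂ b₁ b₀ : ℤ} (hΔ : cubicDisc b₃ b₂ b₁ b₀ ≠ 0)
    (h : HasRationalLinearFactor b₃ b₂ b₁ b₀) : ∃ T ∈ cubicAut b₃ b₂ b₁ b₀, T.det = -1 := by
  obtain ⟨p, q, c₂, c₁, c₀, h⟩ := h
  have hG : c₂ * q ^ 2 - c₁ * p * q + c₀ * p ^ 2 ≠ 0 := by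
    intro hG
    apply hΔ
    have e₃ : (b₃ : ℚ) = p * c₂ := by simpa [cubicFormQ] using h 1 0
    have e₀ : (b₀ : ℚ) = q * c₀ := by simpa [cubicFormQ] using h 0 1
    have h₁ := h 1 1
    have h₂ := h 1 (-1)
    unfold cubicFormQ at h₁ h₂
    have e₂ : (b₂ : ℚ) = p * c₁ + q * c₂ := by
      linear_combination (h₁ - h₂) / 2 - e₀
    have e₁ : (b₁ : ℚ) = p * c₀ + q * c₁ := by
      linear_combination (h₁ + h₂) / 2 - e₃
    have : (cubicDisc b₃ b₂ b₁ b₀ : ℚ) = 0 := by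
      unfold cubicDisc
      push_cast
      rw [e₃, e₂, e₁, e₀]
      linear_combination (c₁ ^ 2 - 4 * c₂ * c₀) * (c₂ * q ^ 2 - c₁ * p * q + c₀ * p ^ 2) * hG
    exact_mod_cast this
  obtain ⟨g, hg⟩ : ∃ g, g * (c₂ * q ^ 2 - c₁ * p * q + c₀ * p ^ 2) = 1 :=
    ⟨_, inv_mul_cancel₀ hG⟩
  have hdet : (!![1 - g * q * (2 * c₂ * q - c₁ * p), -(g * q * (c₁ * q - 2 * c₀ * p));
      g * p * (2 * c₂ * q - c₁ * p), 1 + g * p * (c₁ * q - 2 * c₀ * p)]).det = -1 := by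
    rw [Matrix.det_fin_two_of]
    linear_combination (-2) * hg
  refine ⟨_, ⟨by rw [hdet]; norm_num, fun x y => ?_⟩, hdet⟩
  rw [h, h]
  simp only [Matrix.of_apply, Matrix.cons_val', Matrix.cons_val_zero, Matrix.cons_val_one,
    Matrix.cons_val_fin_one]
  linear_combination (p * x + q * y) * g *
    ((2 * c₂ * q - c₁ * p) * x + (c₁ * q - 2 * c₀ * p) * y) ^ 2 * hg

theorem det_pencil (a b c t k : ℚ) :
    (pencil a b c t k).det = (t ^ 2 - k ^ 2 * (b ^ 2 - 4 * a * c)) / 4 := by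
  rw [pencil, Matrix.det_fin_two_of]
  ring

theorem pencil_sq {a b c k : ℚ} (h : k ^ 2 * (b ^ 2 - 4 * a * c) = -3) :
    pencil a b c (-1) k ^ 2 = pencil a b c (-1) (-k) := by
  rw [sq, pencil, pencil, Matrix.mul_fin_two]
  ext i j
  fin_cases i <;> fin_cases j <;> simp <;> first | ring1 | linear_combination h / 4

theorem pencil_pow_three {a b c k : ℚ} (h : k ^ 2 * (b ^ 2 - 4 * a * c) = -3) :
    pencil a b c (-1) k ^ 3 = 1 := by
  rw [pow_succ, pencil_sq h, pencil, pencil, Matrix.mul_fin_two, Matrix.one_fin_two]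
  ext i j
  fin_cases i <;> fin_cases j <;> simp <;> first | ring1 | linear_combination -h / 4

theorem pencil_mem_cubicAut {b₃ b₂ b₁ b₀ : ℤ} {a b c k : ℚ}
    (ha : a = b₂ ^ 2 - 3 * b₃ * b₁) (hb : b = b₂ * b₁ - 9 * b₃ * b₀)
    (hc : c = b₁ ^ 2 - 3 * b₂ * b₀) (h : k ^ 2 * (b ^ 2 - 4 * a * c) = -3) :
    pencil a b c (-1) k ∈ cubicAut b₃ b₂ b₁ b₀ := by
  refine ⟨by rw [det_pencil, h]; norm_num, fun x y => ?_⟩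
  simp only [pencil, cubicFormQ, Matrix.of_apply, Matrix.cons_val', Matrix.cons_val_zero,
    Matrix.cons_val_one, Matrix.cons_val_fin_one]
  subst ha hb hc
  set a : ℚ := b₂ ^ 2 - 3 * b₃ * b₁ with ha
  set b : ℚ := b₂ * b₁ - 9 * b₃ * b₀ with hb
  set c : ℚ := b₁ ^ 2 - 3 * b₂ * b₀ with hc
  have key : (-3 * (b₃ * x ^ 3 + b₂ * x ^ 2 * y + b₁ * x * y ^ 2 + b₀ * y ^ 3)
      + k / 3 * ((3 * b₃ * x ^ 2 + 2 * b₂ * x * y + b₁ * y ^ 2) * (-b * x - 2 * c * y)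
        + (b₂ * x ^ 2 + 2 * b₁ * x * y + 3 * b₀ * y ^ 2) * (2 * a * x + b * y))) / 8
      * (k ^ 2 * (b ^ 2 - 4 * a * c) + 3) = 0 := by rw [h]; ring
  rw [← sub_eq_zero, ← key, ha, hb, hc]
  ring

/-- An automorphism of determinant `-1` is a reflection, whose `-1`-eigenvector is a zero. -/
theorem hasRationalLinearFactor_of_trace {b₃ b₂ b₁ b₀ : ℤ} (hb₃ : b₃ ≠ 0)
    {T : Matrix (Fin 2) (Fin 2) ℚ} (hT : T ∈ cubicAut b₃ b₂ b₁ b₀)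
    (hdet : T.det = -1) (htr : T 0 0 + T 1 1 = 0) :
    HasRationalLinearFactor b₃ b₂ b₁ b₀ := by
  rw [Matrix.det_fin_two] at hdet
  have zero_of_neg (x y : ℚ) (h₁ : T 0 0 * x + T 0 1 * y = -x)
      (h₂ : T 1 0 * x + T 1 1 * y = -y) : cubicFormQ b₃ b₂ b₁ b₀ x y = 0 := by
    have := hT.2 x y
    rw [h₁, h₂] at this
    unfold cubicFormQ at this ⊢
    linear_combination (-1 / 2 : ℚ) * this
  by_cases h : T 0 0 = 1
  · refine hasRationalLinearFactor_of_zero hb₃ (m := T 0 1) (n := T 1 1 - 1)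
      (zero_of_neg _ _ ?_ ?_) (Or.inr ?_)
    · linear_combination T 0 1 * htr
    · linear_combination -hdet + T 1 1 * htr
    · intro h'
      linarith
  · refine hasRationalLinearFactor_of_zero hb₃ (m := T 0 0 - 1) (n := T 1 0)
      (zero_of_neg _ _ ?_ ?_) (Or.inl (sub_ne_zero.mpr h))
    · linear_combination -hdet + T 0 0 * htr
    · linear_combination T 1 0 * htr

/-- The Hessian of a cubic form is invariant under its automorphisms, which have
determinant `±1`. -/
theorem hessian_invariant {b₃ b₂ b₁ b₀ : ℤ} {a b c : ℚ}
    (ha : a = b₂ ^ 2 - 3 * b₃ * b₁) (hb : b = b₂ * b₁ - 9 * b₃ * b₀)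
    (hc : c = b₁ ^ 2 - 3 * b₂ * b₀) (hD : b ^ 2 - 4 * a * c ≠ 0)
    {T : Matrix (Fin 2) (Fin 2) ℚ} (hT : T ∈ cubicAut b₃ b₂ b₁ b₀) :
    (T.det = 1 ∨ T.det = -1) ∧
      a = a * T 0 0 ^ 2 + b * T 0 0 * T 1 0 + c * T 1 0 ^ 2 ∧
      b = 2 * a * T 0 0 * T 0 1 + b * (T 0 0 * T 1 1 + T 0 1 * T 1 0) + 2 * c * T 1 0 * T 1 1 ∧
      c = a * T 0 1 ^ 2 + b * T 0 1 * T 1 1 + c * T 1 1 ^ 2 := by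
  obtain ⟨-, hT⟩ := hT
  rw [Matrix.det_fin_two]
  generalize T 0 0 = p at *
  generalize T 0 1 = q at *
  generalize T 1 0 = r at *
  generalize T 1 1 = s at *
  have h₁₀ := hT 1 0
  have h₀₁ := hT 0 1
  have h₁₁ := hT 1 1
  have h₁₂ := hT 1 (-1)
  simp only [cubicFormQ] at h₁₀ h₀₁ h₁₁ h₁₂
  obtain ⟨d₃, hd₃⟩ : ∃ d : ℚ, d = b₃ * p ^ 3 + b₂ * p ^ 2 * r + b₁ * p * r ^ 2 + b₀ * r ^ 3 :=
    ⟨_, rfl⟩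
  obtain ⟨d₂, hd₂⟩ : ∃ d : ℚ, d = 3 * b₃ * p ^ 2 * q + b₂ * (p ^ 2 * s + 2 * p * q * r)
      + b₁ * (q * r ^ 2 + 2 * p * r * s) + 3 * b₀ * r ^ 2 * s := ⟨_, rfl⟩
  obtain ⟨d₁, hd₁⟩ : ∃ d : ℚ, d = 3 * b₃ * p * q ^ 2 + b₂ * (q ^ 2 * r + 2 * p * q * s)
      + b₁ * (p * s ^ 2 + 2 * q * r * s) + 3 * b₀ * r * s ^ 2 := ⟨_, rfl⟩
  obtain ⟨d₀, hd₀⟩ : ∃ d : ℚ, d = b₃ * q ^ 3 + b₂ * q ^ 2 * s + b₁ * q * s ^ 2 + b₀ * s ^ 3 :=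
    ⟨_, rfl⟩
  have e₃ : d₃ = b₃ := by linear_combination hd₃ + h₁₀
  have e₀ : d₀ = b₀ := by linear_combination hd₀ + h₀₁
  have e₂ : d₂ = b₂ := by linear_combination hd₂ + (h₁₁ - h₁₂) / 2 - h₀₁
  have e₁ : d₁ = b₁ := by linear_combination hd₁ + (h₁₁ + h₁₂) / 2 - h₁₀
  have ea : a = (p * s - q * r) ^ 2 * (a * p ^ 2 + b * p * r + c * r ^ 2) :=
    calc a = d₂ ^ 2 - 3 * d₃ * d₁ := by rw [e₃, e₂, e₁, ha]
      _ = _ := by rw [hd₃, hd₂, hd₁, ha, hb, hc]; ring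
  have eb : b = (p * s - q * r) ^ 2
      * (2 * a * p * q + b * (p * s + q * r) + 2 * c * r * s) :=
    calc b = d₂ * d₁ - 9 * d₃ * d₀ := by rw [e₃, e₂, e₁, e₀, hb]
      _ = _ := by rw [hd₃, hd₂, hd₁, hd₀, ha, hb, hc]; ring
  have ec : c = (p * s - q * r) ^ 2 * (a * q ^ 2 + b * q * s + c * s ^ 2) :=
    calc c = d₁ ^ 2 - 3 * d₂ * d₀ := by rw [e₂, e₁, e₀, hc]
      _ = _ := by rw [hd₂, hd₁, hd₀, ha, hb, hc]; ring
  have hd6 : (p * s - q * r) ^ 6 = 1 := by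
    have : b ^ 2 - 4 * a * c = (p * s - q * r) ^ 6 * (b ^ 2 - 4 * a * c) := by
      have h : b ^ 2 - 4 * a * c =
          ((p * s - q * r) ^ 2 * (2 * a * p * q + b * (p * s + q * r) + 2 * c * r * s)) ^ 2
          - 4 * ((p * s - q * r) ^ 2 * (a * p ^ 2 + b * p * r + c * r ^ 2))
            * ((p * s - q * r) ^ 2 * (a * q ^ 2 + b * q * s + c * s ^ 2)) := by
        rw [← ea, ← eb, ← ec]
      linear_combination h
    exact mul_right_cancel₀ hD (by rw [← this, one_mul])
  have hd : p * s - q * r = 1 ∨ p * s - q * r = -1 :=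
    (pow_eq_one_iff_cases.mp hd6).resolve_left (by norm_num) |>.imp id And.left
  have hd2 : (p * s - q * r) ^ 2 = 1 := by
    rcases hd with h | h <;> rw [h] <;> norm_num
  rw [hd2, one_mul] at ea eb ec
  exact ⟨hd, ea, eb, ec⟩

/-- The identity `det T • (Q * T) = (adjugate T)ᵀ * Q` for an isometry `T` of the form with
Gram matrix `Q`. -/
theorem adjugate_of_isometry {a b c p q r s : ℚ}
    (ea : a = a * p ^ 2 + b * p * r + c * r ^ 2)
    (eb : b = 2 * a * p * q + b * (p * s + q * r) + 2 * c * r * s)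
    (ec : c = a * q ^ 2 + b * q * s + c * s ^ 2) :
    (p * s - q * r) * (a * p + b * r / 2) = s * a - r * b / 2 ∧
      (p * s - q * r) * (a * q + b * s / 2) = s * b / 2 - r * c ∧
      (p * s - q * r) * (b * p / 2 + c * r) = p * b / 2 - q * a ∧
      (p * s - q * r) * (b * q / 2 + c * s) = p * c - q * b / 2 := by
  refine ⟨?_, ?_, ?_, ?_⟩
  · linear_combination -s * ea + r / 2 * eb
  · linear_combination -s / 2 * eb + r * ec
  · linear_combination q * ea - p / 2 * eb
  · linear_combination q / 2 * eb - p * ec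

theorem trace_eq_zero_of_isometry {a b c p q r s : ℚ} (hD : b ^ 2 - 4 * a * c ≠ 0)
    (hdet : p * s - q * r = -1)
    (ea : a = a * p ^ 2 + b * p * r + c * r ^ 2)
    (eb : b = 2 * a * p * q + b * (p * s + q * r) + 2 * c * r * s)
    (ec : c = a * q ^ 2 + b * q * s + c * s ^ 2) : p + s = 0 := by
  obtain ⟨g₁, g₂, g₃, g₄⟩ := adjugate_of_isometry ea eb ec
  rw [hdet] at g₁ g₂ g₃ g₄
  have : (b ^ 2 - 4 * a * c) * (p + s) = 0 := by
    linear_combination -b * (g₂ + g₃) + 4 * c * g₁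
  exact (mul_eq_zero.mp this).resolve_left hD

/-- The automorphisms of determinant `1` lie in the pencil of the Hessian. -/
theorem exists_pencil_of_det_eq_one {b₃ b₂ b₁ b₀ : ℤ} (hb₃ : b₃ ≠ 0) {a b c : ℚ}
    (ha : a = b₂ ^ 2 - 3 * b₃ * b₁) (hb : b = b₂ * b₁ - 9 * b₃ * b₀)
    (hc : c = b₁ ^ 2 - 3 * b₂ * b₀) (hD : b ^ 2 - 4 * a * c ≠ 0)
    {T : Matrix (Fin 2) (Fin 2) ℚ} (hT : T ∈ cubicAut b₃ b₂ b₁ b₀) (hdet : T.det = 1) :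
    T = 1 ∨ ∃ k, k ^ 2 * (b ^ 2 - 4 * a * c) = -3 ∧ T = pencil a b c (-1) k := by
  obtain ⟨-, ea, eb, ec⟩ := hessian_invariant ha hb hc hD hT
  have hb' : (b₃ : ℚ) ≠ 0 := by exact_mod_cast hb₃
  rw [Matrix.det_fin_two] at hdet
  obtain ⟨g₁, g₂, -, g₄⟩ := adjugate_of_isometry ea eb ec
  rw [hdet] at g₁ g₂ g₄
  obtain ⟨k, hk⟩ : ∃ k, k * (b ^ 2 - 4 * a * c)
      = -b * (T 0 0 - T 1 1) - 2 * c * T 1 0 + 2 * a * T 0 1 := ⟨_, div_mul_cancel₀ _ hD⟩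
  have h₁₀ : T 1 0 = a * k := mul_right_cancel₀ hD (by
    linear_combination b * g₁ - 2 * a * g₂ - a * hk)
  have h₀₁ : T 0 1 = -c * k := mul_right_cancel₀ hD (by
    linear_combination b * g₄ - 2 * c * g₂ + c * hk)
  have htr : T 0 0 - T 1 1 = -b * k := mul_right_cancel₀ hD (by
    linear_combination -2 * c * g₁ + 2 * a * g₄ + b * hk)
  obtain ⟨t, ht⟩ : ∃ t, t = T 0 0 + T 1 1 := ⟨_, rfl⟩
  have h₀₀ : T 0 0 = (t - b * k) / 2 := by linear_combination (htr - ht) / 2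
  have h₁₁ : T 1 1 = (t + b * k) / 2 := by linear_combination -(htr + ht) / 2
  have hTp : T = pencil a b c t k := by
    rw [Matrix.eta_fin_two T, pencil, h₀₀, h₀₁, h₁₀, h₁₁]
  have htk : t ^ 2 - 4 = k ^ 2 * (b ^ 2 - 4 * a * c) := by
    rw [h₀₀, h₀₁, h₁₀, h₁₁] at hdet
    linear_combination 4 * hdet
  have hcub : (t - 2) * (t + 1) ^ 2 = 0 := by
    have g₁ := hT.2 1 0
    have g₂ := hT.2 (T 1 1) (-T 1 0)
    rw [show T 0 0 * T 1 1 + T 0 1 * -T 1 0 = 1 by linear_combination hdet,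
      show T 1 0 * T 1 1 + T 1 1 * -T 1 0 = 0 by ring] at g₂
    rw [h₀₀, h₁₀] at g₁
    rw [h₁₀, h₁₁] at g₂
    unfold cubicFormQ at g₁ g₂
    have key : (b₃ : ℚ) * ((t - 2) * (t + 1) ^ 2)
        = -(-3 / 4 * t * b₃ * (t ^ 2 - 4 - k ^ 2 * (b ^ 2 - 4 * a * c))) := by
      have : (b₃ : ℚ) * ((t - 2) * (t + 1) ^ 2)
          + (-3 / 4 * t * b₃ * (t ^ 2 - 4 - k ^ 2 * (b ^ 2 - 4 * a * c))) = 0 := by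
        rw [ha, hb] at g₁ g₂
        rw [ha, hb, hc]
        linear_combination g₁ - g₂
      linear_combination this
    rw [htk, sub_self, mul_zero, neg_zero] at key
    exact (mul_eq_zero.mp key).resolve_left hb'
  rcases mul_eq_zero.mp hcub with h | h
  · obtain rfl : t = 2 := by linarith
    have hk : k = 0 := by
      have : k ^ 2 * (b ^ 2 - 4 * a * c) = 0 := by rw [← htk]; norm_num
      simpa [hD] using this
    left
    rw [hTp, hk, pencil, Matrix.one_fin_two]
    norm_num
  · obtain rfl : t = -1 := by linarith [pow_eq_zero_iff (two_ne_zero) |>.mp h]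
    exact Or.inr ⟨k, by rw [← htk]; norm_num, hTp⟩

theorem csqrt_sq (z : ℂ) : csqrt z ^ 2 = z := by
  simp [csqrt, ← Complex.cpow_nat_mul]

theorem pencil_map_eq_Nmat {a b c σ : ℚ} (hD : b ^ 2 - 4 * a * c ≠ 0)
    (hσ : (σ : ℂ) = csqrt (-3 * ((b : ℂ) ^ 2 - 4 * a * c))) :
    (pencil a b c (-1) (-σ / (b ^ 2 - 4 * a * c))).map (fun q : ℚ => (q : ℂ)) = Nmat a b c := by
  have hD' : (b : ℂ) ^ 2 - 4 * a * c ≠ 0 := by exact_mod_cast hD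
  unfold Nmat pencil
  rw [← hσ]
  ext i j
  fin_cases i <;> fin_cases j <;> simp <;> field_simp <;> ring

/-- If `N_f` is rational then so is the square root occurring in it. -/
theorem exists_rat_csqrt {a b c : ℚ} (hD : b ^ 2 - 4 * a * c ≠ 0)
    {N : Matrix (Fin 2) (Fin 2) ℚ} (hN : N.map (fun q : ℚ => (q : ℂ)) = Nmat a b c) :
    ∃ σ : ℚ, (σ : ℂ) = csqrt (-3 * ((b : ℂ) ^ 2 - 4 * a * c)) := by
  have hD' : (b : ℂ) ^ 2 - 4 * a * c ≠ 0 := by exact_mod_cast hD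
  have h₀₀ := congrFun (congrFun hN 0) 0
  have h₀₁ := congrFun (congrFun hN 0) 1
  have h₁₁ := congrFun (congrFun hN 1) 1
  simp only [Nmat, Matrix.map_apply, Matrix.smul_apply, Matrix.of_apply, Matrix.cons_val',
    Matrix.cons_val_zero, Matrix.cons_val_one, Matrix.cons_val_fin_one, smul_eq_mul]
    at h₀₀ h₀₁ h₁₁
  generalize csqrt (-3 * ((b : ℂ) ^ 2 - 4 * a * c)) = s at *
  by_cases hb : b = 0
  · have hc : c ≠ 0 := by
      rintro rfl
      simp [hb] at hD
    have hc' : (c : ℂ) ≠ 0 := by exact_mod_cast hc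
    refine ⟨N 0 1 * (b ^ 2 - 4 * a * c) / c, ?_⟩
    push_cast
    rw [h₀₁]
    field_simp
  · have hb' : (b : ℂ) ≠ 0 := by exact_mod_cast hb
    refine ⟨(N 0 0 - N 1 1) * (b ^ 2 - 4 * a * c) / b, ?_⟩
    push_cast
    rw [h₀₀, h₁₁]
    field_simp
    ring

/-- For a binary cubic form with integer coefficients, non-zero discriminant and non-zero
`x³`-coefficient, the rational automorphism group is the cyclic group of order 3 generated
by `𝒩_{q_F} ∈ GL₂(ℚ)` iff `F` is irreducible over `ℚ` and `Δ(F)` is a rational square. -/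
theorem cubic_aut_cyclic_three_iff (b₃ b₂ b₁ b₀ : ℤ) (hb₃ : b₃ ≠ 0)
    (hΔ : cubicDisc b₃ b₂ b₁ b₀ ≠ 0) :
    (∃ N : Matrix (Fin 2) (Fin 2) ℚ,
        N.map (fun q : ℚ => (q : ℂ)) = NqF b₃ b₂ b₁ b₀ ∧
        cubicAut b₃ b₂ b₁ b₀ = {1, N, N ^ 2} ∧ N ^ 3 = 1 ∧ N ≠ 1) ↔
      ¬ HasRationalLinearFactor b₃ b₂ b₁ b₀ ∧
        ∃ r : ℚ, (cubicDisc b₃ b₂ b₁ b₀ : ℚ) = r ^ 2 := by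
  have hdisc := cubicDisc_cast b₃ b₂ b₁ b₀
  have hNqF : NqF b₃ b₂ b₁ b₀ = Nmat (((b₂ ^ 2 - 3 * b₃ * b₁ : ℤ) : ℚ) : ℂ)
      (((b₂ * b₁ - 9 * b₃ * b₀ : ℤ) : ℚ) : ℂ) (((b₁ ^ 2 - 3 * b₂ * b₀ : ℤ) : ℚ) : ℂ) := by
    simp only [NqF, Rat.cast_intCast]
  obtain ⟨a, ha⟩ : ∃ a : ℚ, a = ((b₂ ^ 2 - 3 * b₃ * b₁ : ℤ) : ℚ) := ⟨_, rfl⟩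
  obtain ⟨b, hb⟩ : ∃ b : ℚ, b = ((b₂ * b₁ - 9 * b₃ * b₀ : ℤ) : ℚ) := ⟨_, rfl⟩
  obtain ⟨c, hc⟩ : ∃ c : ℚ, c = ((b₁ ^ 2 - 3 * b₂ * b₀ : ℤ) : ℚ) := ⟨_, rfl⟩
  rw [← ha, ← hb, ← hc] at hdisc hNqF
  push_cast at ha hb hc
  have hΔ' : (cubicDisc b₃ b₂ b₁ b₀ : ℚ) ≠ 0 := by exact_mod_cast hΔ
  have hD : b ^ 2 - 4 * a * c ≠ 0 := by
    rw [← hdisc]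
    exact mul_ne_zero (by norm_num) hΔ'
  rw [hNqF]
  constructor
  · rintro ⟨N, hN, hAut, hN3, -⟩
    have hdetN : N.det = 1 := by
      have : N.det ^ 3 = 1 := by rw [← Matrix.det_pow, hN3, Matrix.det_one]
      exact (pow_eq_one_iff_cases.mp this).resolve_left (by norm_num) |>.resolve_right
        (fun h => absurd h.2 (by decide))
    refine ⟨fun hlin => ?_, ?_⟩
    · obtain ⟨T, hT, hdet⟩ := exists_mem_cubicAut_det_eq_neg_one hΔ hlin
      rw [hAut] at hT
      rcases hT with rfl | rfl | rfl
      · norm_num at hdet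
      · norm_num [hdetN] at hdet
      · norm_num [hdetN] at hdet
    · obtain ⟨σ, hσ⟩ := exists_rat_csqrt hD hN
      have hσ2 : σ ^ 2 = -3 * (b ^ 2 - 4 * a * c) := by
        have := csqrt_sq (-3 * ((b : ℂ) ^ 2 - 4 * a * c))
        rw [← hσ] at this
        exact_mod_cast this
      exact ⟨σ / 3, by linear_combination (-1 / 3) * hdisc - hσ2 / 9⟩
  · rintro ⟨hirr, r, hr⟩
    obtain ⟨σ, hσ⟩ : ∃ σ : ℚ, (σ : ℂ) = csqrt (-3 * ((b : ℂ) ^ 2 - 4 * a * c)) := by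
      have hsq := csqrt_sq (-3 * ((b : ℂ) ^ 2 - 4 * a * c))
      have : -3 * ((b : ℂ) ^ 2 - 4 * a * c) = ((3 * r : ℚ) : ℂ) ^ 2 := by
        have : -3 * (b ^ 2 - 4 * a * c) = (3 * r) ^ 2 := by
          linear_combination 3 * hdisc + 9 * hr
        exact_mod_cast this
      rw [this] at hsq ⊢
      rcases sq_eq_sq_iff_eq_or_eq_neg.mp hsq with h | h
      · exact ⟨3 * r, h.symm⟩
      · exact ⟨-(3 * r), by rw [h]; push_cast; ring⟩
    have hσ2 : σ ^ 2 = -3 * (b ^ 2 - 4 * a * c) := by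
      have := csqrt_sq (-3 * ((b : ℂ) ^ 2 - 4 * a * c))
      rw [← hσ] at this
      exact_mod_cast this
    have hmap := pencil_map_eq_Nmat hD hσ
    obtain ⟨k, hk⟩ : ∃ k, k = -σ / (b ^ 2 - 4 * a * c) := ⟨_, rfl⟩
    rw [← hk] at hmap
    have hk2 : k ^ 2 * (b ^ 2 - 4 * a * c) = -3 := by
      rw [hk]
      field_simp
      linear_combination hσ2
    have hk2' : (-k) ^ 2 * (b ^ 2 - 4 * a * c) = -3 := by rw [neg_sq, hk2]
    refine ⟨_, hmap, ?_, pencil_pow_three hk2, fun h => ?_⟩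
    · rw [pencil_sq hk2]
      ext T
      simp only [Set.mem_insert_iff, Set.mem_singleton_iff]
      constructor
      · intro hT
        obtain ⟨hdet, ea, eb, ec⟩ := hessian_invariant ha hb hc hD hT
        rcases hdet with hdet | hdet
        · rcases exists_pencil_of_det_eq_one hb₃ ha hb hc hD hT hdet with h | ⟨l, hl, h⟩
          · exact Or.inl h
          · have : l ^ 2 = k ^ 2 := mul_right_cancel₀ hD (hl.trans hk2.symm)
            rcases sq_eq_sq_iff_eq_or_eq_neg.mp this with rfl | rfl
            · exact Or.inr (Or.inl h)
            · exact Or.inr (Or.inr h)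
        · exact absurd (hasRationalLinearFactor_of_trace hb₃ hT hdet
            (trace_eq_zero_of_isometry hD (by rwa [Matrix.det_fin_two] at hdet) ea eb ec)) hirr
      · rintro (rfl | rfl | rfl)
        · exact ⟨by simp, fun x y => by simp⟩
        · exact pencil_mem_cubicAut ha hb hc hk2
        · exact pencil_mem_cubicAut ha hb hc hk2'
    · have := congrArg (fun M => M 0 0 + M 1 1) h
      norm_num [pencil] at this
      linarith
end

section
/- Let F be a binary cubic form with integer coefficients, non-zero discriminant, and non-zero x³-coefficient. Then Aut F is the cyclic group of order 2 generated by the matrix 𝒯_θ if and only if F(x,1) has exactly one rational root θ (i.e., F has exactly one linear factor over ℚ). -/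
/-- The matrix `M_f = [[b, 2c], [−2a, −b]]` attached to a binary quadratic form
`f = ax² + bxy + cy²`. -/
def Mmat (a b c : ℚ) : Matrix (Fin 2) (Fin 2) ℚ :=
  !![b, 2 * c; -2 * a, -b]

/-- The matrix `𝒯_θ = (−1/(6Δ(F))) · M_{J_θ} · M_{q_F}`, where `J_θ` is the Julia covariant
of `F` at the root `θ` and `q_F` is the Hessian covariant of `F`. -/
def Tmat (b₃ b₂ b₁ b₀ : ℤ) (θ : ℚ) : Matrix (Fin 2) (Fin 2) ℚ :=
  (-(6 * (cubicDisc b₃ b₂ b₁ b₀ : ℚ))⁻¹) •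
    (Mmat (9 * (b₃ : ℚ) ^ 2 * θ ^ 2 + 6 * (b₃ : ℚ) * (b₂ : ℚ) * θ
          + 6 * (b₃ : ℚ) * (b₁ : ℚ) - (b₂ : ℚ) ^ 2)
        (6 * (b₃ : ℚ) * (b₂ : ℚ) * θ ^ 2 + 6 * ((b₂ : ℚ) ^ 2 - (b₃ : ℚ) * (b₁ : ℚ)) * θ
          + 2 * (b₂ : ℚ) * (b₁ : ℚ))
        (3 * (b₃ : ℚ) * (b₁ : ℚ) * θ ^ 2
          + 3 * ((b₂ : ℚ) * (b₁ : ℚ) - 3 * (b₃ : ℚ) * (b₀ : ℚ)) * θ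
          + 2 * (b₁ : ℚ) ^ 2 - 3 * (b₂ : ℚ) * (b₀ : ℚ)) *
      Mmat ((b₂ : ℚ) ^ 2 - 3 * (b₃ : ℚ) * (b₁ : ℚ))
        ((b₂ : ℚ) * (b₁ : ℚ) - 9 * (b₃ : ℚ) * (b₀ : ℚ))
        ((b₁ : ℚ) ^ 2 - 3 * (b₂ : ℚ) * (b₀ : ℚ)))

/-- The involution of determinant `-1` that fixes the linear form `x - θ y` and has lower left
entry `-r`. -/
def rootInvolution (θ r : ℚ) : Matrix (Fin 2) (Fin 2) ℚ :=
  !![1 - θ * r, θ * (θ * r - 2); -r, θ * r - 1]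

theorem rootInvolution_sq (θ r : ℚ) : rootInvolution θ r ^ 2 = 1 := by
  rw [pow_two, rootInvolution, Matrix.mul_fin_two, Matrix.one_fin_two]
  ext i j
  fin_cases i <;> fin_cases j <;> simp <;> ring

theorem rootInvolution_det (θ r : ℚ) : (rootInvolution θ r).det = -1 := by
  rw [rootInvolution, Matrix.det_fin_two_of]
  ring

theorem rootInvolution_ne_one (θ r : ℚ) : rootInvolution θ r ≠ 1 := by
  intro h
  have := rootInvolution_det θ r
  rw [h, Matrix.det_one] at this
  norm_num at this

/-- The matrix `rootInvolution θ r` determines `θ`. -/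
theorem rootInvolution_left_injective {θ θ' r r' : ℚ}
    (h : rootInvolution θ r = rootInvolution θ' r') : θ = θ' := by
  have h00 := congrFun (congrFun h 0) 0
  have h01 := congrFun (congrFun h 0) 1
  have h10 := congrFun (congrFun h 1) 0
  simp [rootInvolution] at h00 h01 h10
  subst h10
  linear_combination (-1 / 2) * h01 + (θ / 2) * h00 + (θ' / 2) * h00

section Root

variable {b₃ b₂ b₁ b₀ : ℤ} {θ : ℚ}

theorem constant_coeff_eq_of_root (h : cubicFormQ b₃ b₂ b₁ b₀ θ 1 = 0) :
    (b₀ : ℚ) = -(b₃ * θ ^ 3 + b₂ * θ ^ 2 + b₁ * θ) := by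
  simp only [cubicFormQ] at h
  linear_combination h

theorem cubicDisc_eq_of_root (h : cubicFormQ b₃ b₂ b₁ b₀ θ 1 = 0) :
    (cubicDisc b₃ b₂ b₁ b₀ : ℚ) = (3 * b₃ * θ ^ 2 + 2 * b₂ * θ + b₁) ^ 2 *
      ((3 * b₃ * θ + b₂) ^ 2 - 4 * b₃ * (3 * b₃ * θ ^ 2 + 2 * b₂ * θ + b₁)) := by
  simp only [cubicDisc]
  push_cast
  rw [constant_coeff_eq_of_root h]
  ring

theorem cubicFormQ_shift_of_root (h : cubicFormQ b₃ b₂ b₁ b₀ θ 1 = 0) (x y : ℚ) :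
    cubicFormQ b₃ b₂ b₁ b₀ (x + θ * y) y = x * (b₃ * x ^ 2 + (3 * b₃ * θ + b₂) * x * y +
      (3 * b₃ * θ ^ 2 + 2 * b₂ * θ + b₁) * y ^ 2) := by
  rw [cubicFormQ, constant_coeff_eq_of_root h]
  ring

theorem deriv_and_disc_ne_zero_of_root (hΔ : cubicDisc b₃ b₂ b₁ b₀ ≠ 0)
    (h : cubicFormQ b₃ b₂ b₁ b₀ θ 1 = 0) :
    (3 * b₃ * θ ^ 2 + 2 * b₂ * θ + b₁ : ℚ) ≠ 0 ∧
      ((3 * b₃ * θ + b₂) ^ 2 - 4 * b₃ * (3 * b₃ * θ ^ 2 + 2 * b₂ * θ + b₁) : ℚ) ≠ 0 := by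
  have hΔ' : (cubicDisc b₃ b₂ b₁ b₀ : ℚ) ≠ 0 := Int.cast_ne_zero.mpr hΔ
  rw [cubicDisc_eq_of_root h] at hΔ'
  exact ⟨fun h0 => hΔ' (by simp [h0]), right_ne_zero_of_mul hΔ'⟩

theorem Tmat_eq_rootInvolution (hΔ : cubicDisc b₃ b₂ b₁ b₀ ≠ 0)
    (h : cubicFormQ b₃ b₂ b₁ b₀ θ 1 = 0) :
    Tmat b₃ b₂ b₁ b₀ θ = rootInvolution θ
      ((3 * b₃ * θ + b₂) / (3 * b₃ * θ ^ 2 + 2 * b₂ * θ + b₁)) := by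
  obtain ⟨hq, hd⟩ := deriv_and_disc_ne_zero_of_root hΔ h
  rw [Tmat, cubicDisc_eq_of_root h, constant_coeff_eq_of_root h, Mmat, Mmat, rootInvolution,
    Matrix.mul_fin_two]
  generalize hqq : (3 * b₃ * θ ^ 2 + 2 * b₂ * θ + b₁ : ℚ) = q at *
  generalize hpp : (3 * b₃ * θ + b₂ : ℚ) = p at *
  have hb₁ : (b₁ : ℚ) = q - 3 * b₃ * θ ^ 2 - 2 * b₂ * θ := by linear_combination hqq
  have hb₂ : (b₂ : ℚ) = p - 3 * b₃ * θ := by linear_combination hpp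
  rw [hb₁, hb₂]
  ext i j
  fin_cases i <;> fin_cases j <;> simp <;> field_simp <;> ring

/-- The involution attached to a rational root is an automorphism of the cubic form. -/
theorem rootInvolution_mem_cubicAut (hΔ : cubicDisc b₃ b₂ b₁ b₀ ≠ 0)
    (h : cubicFormQ b₃ b₂ b₁ b₀ θ 1 = 0) :
    rootInvolution θ ((3 * b₃ * θ + b₂) / (3 * b₃ * θ ^ 2 + 2 * b₂ * θ + b₁)) ∈
      cubicAut b₃ b₂ b₁ b₀ := by
  obtain ⟨hq, -⟩ := deriv_and_disc_ne_zero_of_root hΔ h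
  refine ⟨by rw [rootInvolution_det]; norm_num, fun x y => ?_⟩
  set p : ℚ := 3 * b₃ * θ + b₂ with hp
  set q : ℚ := 3 * b₃ * θ ^ 2 + 2 * b₂ * θ + b₁ with hqq
  have e₁ := cubicFormQ_shift_of_root h (x - θ * y) (-(p / q) * x + (θ * (p / q) - 1) * y)
  have e₂ := cubicFormQ_shift_of_root h (x - θ * y) y
  rw [← hp, ← hqq] at e₁ e₂
  rw [sub_add_cancel] at e₂
  rw [e₂]
  convert e₁ using 1
  · congr 1
    simp [rootInvolution]
    ring
  · field_simp
    ring

theorem one_mem_cubicAut : (1 : Matrix (Fin 2) (Fin 2) ℚ) ∈ cubicAut b₃ b₂ b₁ b₀ := by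
  simp [cubicAut]

/-- An automorphism maps the line spanned by a unique rational root to itself. -/
theorem map_root_of_mem_cubicAut (hb₃ : b₃ ≠ 0) (h : cubicFormQ b₃ b₂ b₁ b₀ θ 1 = 0)
    (hu : ∀ θ' : ℚ, cubicFormQ b₃ b₂ b₁ b₀ θ' 1 = 0 → θ' = θ)
    {T : Matrix (Fin 2) (Fin 2) ℚ} (hT : T ∈ cubicAut b₃ b₂ b₁ b₀) :
    T 0 0 * θ + T 0 1 = θ * (T 1 0 * θ + T 1 1) := by
  have hroot := hT.2 θ 1
  rw [h, mul_one, mul_one] at hroot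
  have hb : (b₃ : ℚ) ≠ 0 := Int.cast_ne_zero.mpr hb₃
  by_cases ht : T 1 0 * θ + T 1 1 = 0
  · rw [ht] at hroot ⊢
    have hs : T 0 0 * θ + T 0 1 = 0 := by simpa [cubicFormQ, hb] using hroot
    rw [hs, mul_zero]
  · rw [← div_eq_iff ht]
    apply hu
    generalize T 1 0 * θ + T 1 1 = t at *
    simp only [cubicFormQ] at hroot ⊢
    field_simp
    linear_combination hroot

/-- When `θ` is the unique rational root, the only automorphisms of the form are the identity and
the involution attached to `θ`. -/
theorem eq_one_or_rootInvolution_of_mem_cubicAut (hb₃ : b₃ ≠ 0)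
    (hΔ : cubicDisc b₃ b₂ b₁ b₀ ≠ 0) (h : cubicFormQ b₃ b₂ b₁ b₀ θ 1 = 0)
    (hu : ∀ θ' : ℚ, cubicFormQ b₃ b₂ b₁ b₀ θ' 1 = 0 → θ' = θ)
    {T : Matrix (Fin 2) (Fin 2) ℚ} (hT : T ∈ cubicAut b₃ b₂ b₁ b₀) :
    T = 1 ∨ T = rootInvolution θ
      ((3 * b₃ * θ + b₂) / (3 * b₃ * θ ^ 2 + 2 * b₂ * θ + b₁)) := by
  obtain ⟨hq, hd⟩ := deriv_and_disc_ne_zero_of_root hΔ h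
  have hline := map_root_of_mem_cubicAut hb₃ h hu hT
  have hF : ∀ x y : ℚ, _ := fun x y => (cubicFormQ_shift_of_root h
    ((T 0 0 - θ * T 1 0) * x) (T 1 0 * x + (T 1 0 * θ + T 1 1) * y)).symm.trans <|
    (congrArg₂ (cubicFormQ b₃ b₂ b₁ b₀) (by linear_combination -y * hline) (by ring)).trans <|
    (hT.2 (x + θ * y) y).trans (cubicFormQ_shift_of_root h x y)
  generalize (3 * b₃ * θ ^ 2 + 2 * b₂ * θ + b₁ : ℚ) = q at *
  generalize (3 * b₃ * θ + b₂ : ℚ) = p at *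
  generalize hu' : T 0 0 - θ * T 1 0 = u at *
  generalize hl : T 1 0 * θ + T 1 1 = l at *
  generalize hv : T 1 0 = v at *
  have f₀ := hF 1 0
  have f₁ := hF 1 1
  have f₂ := hF 1 (-1)
  have hxx : u * (b₃ * u ^ 2 + p * u * v + q * v ^ 2) = b₃ := by linear_combination f₀
  have hxy : u * (p * u * l + 2 * q * v * l) = p := by linear_combination (f₁ - f₂) / 2
  have hyy : u * l ^ 2 = 1 :=
    mul_right_cancel₀ hq (by linear_combination (f₁ + f₂) / 2 - f₀)
  have hu3 : u ^ 3 = 1 := mul_right_cancel₀ hd (by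
    linear_combination -4 * q * hxx + (p + u * (p * u * l + 2 * q * v * l)) * hxy -
      u * (p * u + 2 * q * v) ^ 2 * hyy)
  have hu1 : u = 1 := (Odd.strictMono_pow (by decide : Odd 3)).injective (by simpa using hu3)
  subst hu1
  have h00 : T 0 0 = 1 + θ * v := by linear_combination hu'
  have h11 : T 1 1 = l - v * θ := by linear_combination hl
  have h01 : T 0 1 = θ * l - T 0 0 * θ := by linear_combination hline
  rw [one_mul, sq_eq_one_iff] at hyy
  rcases hyy with rfl | rfl
  · left
    have hv0 : v = 0 := by
      have : q * v = 0 := by linear_combination hxy / 2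
      exact (mul_eq_zero.mp this).resolve_left hq
    subst hv0
    ext i j
    fin_cases i <;> fin_cases j <;> simp [h00, h01, h11, hv]
  · right
    obtain rfl : v = -(p / q) := by
      field_simp
      linear_combination -hxy / 2
    ext i j
    fin_cases i <;> fin_cases j <;> simp [rootInvolution, h00, h01, h11, hv] <;> ring

end Root

/-- For a binary cubic form with integer coefficients, non-zero discriminant and non-zero
`x³`-coefficient, and a rational number `θ`: `θ` is the unique rational root of `F(x,1)`
iff the rational automorphism group of `F` is the cyclic group of order 2 generated by
`𝒯_θ`. -/
theorem cubic_aut_cyclic_two_iff (b₃ b₂ b₁ b₀ : ℤ) (hb₃ : b₃ ≠ 0)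
    (hΔ : cubicDisc b₃ b₂ b₁ b₀ ≠ 0) (θ : ℚ) :
    (cubicFormQ b₃ b₂ b₁ b₀ θ 1 = 0 ∧
        ∀ θ' : ℚ, cubicFormQ b₃ b₂ b₁ b₀ θ' 1 = 0 → θ' = θ) ↔
      (cubicFormQ b₃ b₂ b₁ b₀ θ 1 = 0 ∧
        cubicAut b₃ b₂ b₁ b₀ = {1, Tmat b₃ b₂ b₁ b₀ θ} ∧
        Tmat b₃ b₂ b₁ b₀ θ ^ 2 = 1 ∧ Tmat b₃ b₂ b₁ b₀ θ ≠ 1) := by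
  constructor
  · rintro ⟨h, hu⟩
    rw [Tmat_eq_rootInvolution hΔ h]
    refine ⟨h, Set.Subset.antisymm ?_ ?_, rootInvolution_sq _ _, rootInvolution_ne_one _ _⟩
    · exact fun T hT => eq_one_or_rootInvolution_of_mem_cubicAut hb₃ hΔ h hu hT
    · rintro T (rfl | rfl)
      exacts [one_mem_cubicAut, rootInvolution_mem_cubicAut hΔ h]
  · rintro ⟨h, hAut, -, -⟩
    refine ⟨h, fun θ' h' => ?_⟩
    have hmem := rootInvolution_mem_cubicAut hΔ h'
    rw [hAut, Tmat_eq_rootInvolution hΔ h] at hmem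
    exact rootInvolution_left_injective (hmem.resolve_left (rootInvolution_ne_one _ _))
end
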